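/- arXiv:2004.12818 — 3 statements merged into one kernel-verified Lean document; each statement's English description precedes it below -/
import Mathlib

section
/- Let m > n ≥ 1, let A ∈ Mat(ℝ, m, n) be written in block form A = [A₁; A₂] with A₁ ∈ Mat(ℝ, m−n, n) and A₂ ∈ Mat(ℝ, n, n) invertible, and let A⁺ ∈ Mat(ℝ, n, m) be the Moore-Penrose inverse of A. Then for every c ∈ ℝᵐ, A A⁺ c = c if and only if U c = 0, where U ∈ Mat(ℝ, m, m) is the block matrix U = [[I_{m−n}, −A₁A₂⁻¹], [0_{n,m−n}, 0_{n,n}]]. -/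
open Matrix

/-- For `A = [A₁; A₂]` (m = p + n rows, `m > n ≥ 1` i.e. `p ≥ 1`), `A₂`
invertible, and `Ap` the Moore-Penrose inverse of `A`, for every `c`,
`A A⁺ c = c ↔ U c = 0` where `U = [[I, −A₁A₂⁻¹],[0,0]]`. -/
theorem stmt0 (p n : ℕ) (hp : 1 ≤ p) (hn : 1 ≤ n)
    (A₁ : Matrix (Fin p) (Fin n) ℝ) (A₂ : Matrix (Fin n) (Fin n) ℝ)
    (hA₂ : IsUnit A₂.det)
    (A : Matrix (Fin p ⊕ Fin n) (Fin n) ℝ)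
    (hA : A = Matrix.fromRows A₁ A₂)
    (Ap : Matrix (Fin n) (Fin p ⊕ Fin n) ℝ)
    (h1 : A * Ap * A = A) (h2 : Ap * A * Ap = Ap)
    (h3 : (A * Ap)ᵀ = A * Ap) (h4 : (Ap * A)ᵀ = Ap * A)
    (U : Matrix (Fin p ⊕ Fin n) (Fin p ⊕ Fin n) ℝ)
    (hU : U = Matrix.fromBlocks 1 (-(A₁ * A₂⁻¹)) 0 0) :
    ∀ c : (Fin p ⊕ Fin n) → ℝ, (A * Ap) *ᵥ c = c ↔ U *ᵥ c = 0 := by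
  have hUA : U * A = 0 := by
    rw [hU, hA, fromBlocks_mul_fromRows, Matrix.neg_mul,
      nonsing_inv_mul_cancel_right _ _ hA₂]
    ext (i | i) j <;> simp
  intro c
  constructor
  · intro hc
    rw [← hc, mulVec_mulVec, ← Matrix.mul_assoc, hUA, Matrix.zero_mul, zero_mulVec]
  · intro hc
    have hc₁ : c ∘ Sum.inl = (A₁ * A₂⁻¹) *ᵥ (c ∘ Sum.inr) := by
      rw [hU, fromBlocks_mulVec] at hc
      funext i
      have hi := congrFun hc (Sum.inl i)
      simp only [Sum.elim_inl, one_mulVec, neg_mulVec, Pi.add_apply, Pi.neg_apply,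
        Pi.zero_apply] at hi
      linarith
    have hrange : A *ᵥ (A₂⁻¹ *ᵥ (c ∘ Sum.inr)) = c := by
      rw [hA, fromRows_mulVec, mulVec_mulVec, mulVec_mulVec, mul_nonsing_inv _ hA₂,
        one_mulVec, ← hc₁, Sum.elim_comp_inl_inr]
    rw [← hrange, mulVec_mulVec, h1]
end

section
/- Let m > n ≥ 1, let A ∈ Mat(ℝ, m, n) have no null row and be written in block form A = [A₁; A₂] with A₁ ∈ Mat(ℝ, m−n, n) and A₂ ∈ Mat(ℝ, n, n) invertible, and let b ∈ ℝᵐ. Let U ∈ Mat(ℝ, m, m) be the block matrix U = [[I_{m−n}, −A₁A₂⁻¹], [0_{n,m−n}, 0_{n,n}]], with entries u_{i,j}. For i ∈ {1, …, m−n} let B_i := {j ∈ {1,…,m} : u_{i,j} ≠ 0}, and for j ∈ {1,…,m} let L_j := {x ∈ ℝⁿ : a_{j,·} x ≤ b_j}, where a_{j,·} is the j-th row of A. Then for every i ∈ {1, …, m−n}: there exists c ∈ ℝᵐ with c ≤ b and Σ_{j=1}^{m} u_{i,j} c_j = 0, if and only if ∩_{j ∈ B_i} L_j ≠ ∅. 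-/
open Matrix

/-- With `A = [A₁; A₂]` (`m = p + n`, `p ≥ 1`, `n ≥ 1`), `A` having no
null row, `A₂` invertible, `U = [[I, −A₁A₂⁻¹],[0,0]]`, `B i = {j : u_{i,j} ≠ 0}`,
`L j = {x : a_{j,·} x ≤ b j}`: for every `i ∈ [m−n]`,
`(∃ c ≤ b, Σ_j u_{i,j} c_j = 0) ↔ ⋂_{j ∈ B i} L j ≠ ∅`. -/
theorem stmt3 (p n : ℕ) (hp : 1 ≤ p) (hn : 1 ≤ n)
    (A₁ : Matrix (Fin p) (Fin n) ℝ) (A₂ : Matrix (Fin n) (Fin n) ℝ)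
    (hA₂ : IsUnit A₂.det)
    (A : Matrix (Fin p ⊕ Fin n) (Fin n) ℝ)
    (hA : A = Matrix.fromRows A₁ A₂)
    (hnorow : ∀ j : Fin p ⊕ Fin n, A j ≠ 0)
    (b : (Fin p ⊕ Fin n) → ℝ)
    (U : Matrix (Fin p ⊕ Fin n) (Fin p ⊕ Fin n) ℝ)
    (hU : U = Matrix.fromBlocks 1 (-(A₁ * A₂⁻¹)) 0 0)
    (B : Fin p → Set (Fin p ⊕ Fin n))
    (hB : ∀ i : Fin p, B i = {j : Fin p ⊕ Fin n | U (Sum.inl i) j ≠ 0})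
    (L : (Fin p ⊕ Fin n) → Set (Fin n → ℝ))
    (hL : ∀ j : Fin p ⊕ Fin n, L j = {x : Fin n → ℝ | A j ⬝ᵥ x ≤ b j}) :
    ∀ i : Fin p,
      (∃ c : (Fin p ⊕ Fin n) → ℝ, c ≤ b ∧ ∑ j, U (Sum.inl i) j * c j = 0) ↔
        (⋂ j ∈ B i, L j).Nonempty := by
  intro i
  have hdet : A₂ * A₂⁻¹ = 1 := Matrix.mul_nonsing_inv A₂ hA₂
  constructor
  · rintro ⟨c, hcb, hc⟩
    have hA₂x : A₂ *ᵥ (A₂⁻¹ *ᵥ fun k => c (Sum.inr k)) = fun k => c (Sum.inr k) := by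
      rw [Matrix.mulVec_mulVec, hdet, Matrix.one_mulVec]
    refine ⟨A₂⁻¹ *ᵥ fun k => c (Sum.inr k), Set.mem_iInter₂.2 fun j hj => ?_⟩
    rw [hL, Set.mem_ofPred_eq]
    rw [hB, Set.mem_ofPred_eq, hU] at hj
    refine le_trans (le_of_eq ?_) (hcb j)
    rcases j with k | k
    · obtain rfl : i = k := by
        by_contra hik
        exact hj (by simp [Matrix.one_apply_ne hik])
      have hrow : c (Sum.inl i) - ((A₁ * A₂⁻¹) *ᵥ fun k => c (Sum.inr k)) i = 0 := by
        rw [← hc, hU]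
        simp [Fintype.sum_sum_type, Matrix.one_apply, Matrix.mulVec, dotProduct, sub_eq_add_neg]
      rw [← Matrix.mulVec_mulVec] at hrow
      rw [hA]
      exact (sub_eq_zero.1 hrow).symm
    · rw [hA]
      exact congrFun hA₂x k
  · rintro ⟨x, hx⟩
    have hUA : U * A = 0 := by
      rw [hU, hA, Matrix.fromBlocks_mul_fromRows, Matrix.neg_mul, Matrix.mul_assoc,
        Matrix.nonsing_inv_mul A₂ hA₂]
      simp
    refine ⟨fun j => if U (Sum.inl i) j = 0 then b j else A j ⬝ᵥ x, fun j => ?_, ?_⟩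
    · by_cases hj : U (Sum.inl i) j = 0
      · simp [hj]
      · have hxj := Set.mem_iInter₂.1 hx j (by rw [hB]; exact hj)
        rw [hL] at hxj
        simpa [hj] using hxj
    · calc
        _ = ∑ j, U (Sum.inl i) j * (A *ᵥ x) j := by
          refine Finset.sum_congr rfl fun j _ => ?_
          by_cases hj : U (Sum.inl i) j = 0
          · simp [hj]
          · simp [hj, Matrix.mulVec]
        _ = ((U * A) *ᵥ x) (Sum.inl i) := by
          rw [← Matrix.mulVec_mulVec]; rfl
        _ = 0 := by simp [hUA]
end

section
/- Let m > n ≥ 1, let A ∈ Mat(ℝ, m, n) be written in block form A = [A₁; A₂] with A₁ ∈ Mat(ℝ, m−n, n) and A₂ ∈ Mat(ℝ, n, n) invertible, and let b ∈ ℝᵐ. Let U ∈ Mat(ℝ, m, m) be the block matrix U = [[I_{m−n}, −A₁A₂⁻¹], [0_{n,m−n}, 0_{n,n}]]. Then the polyhedron P(A, b) := {x ∈ ℝⁿ : A x ≤ b} is nonempty if and only if for every k ∈ ℝᵐ there exists c ∈ ℝᵐ with c ≤ b and kᵀ U c = 0. -/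
open Matrix

/-- A finite system `a i * t ≤ r i` in one real unknown is solvable as soon as the conditions
with zero coefficient hold and every lower bound lies below every upper bound. -/
lemma exists_forall_mul_le_of_pairwise {ι : Type*} [Finite ι] (a r : ι → ℝ)
    (hzero : ∀ i, a i = 0 → 0 ≤ r i)
    (hpair : ∀ i k, 0 < a i → a k < 0 → 0 ≤ -a k * r i + a i * r k) :
    ∃ t : ℝ, ∀ i, a i * t ≤ r i := by
  have hbounds : ∃ t : ℝ, (∀ k, a k < 0 → r k / a k ≤ t) ∧ ∀ i, 0 < a i → t ≤ r i / a i := by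
    have hle : ∀ i k, 0 < a i → a k < 0 → r k / a k ≤ r i / a i := by
      intro i k hi hk
      rw [div_le_iff_of_neg hk, div_mul_eq_mul_div, div_le_iff₀ hi]
      linarith [hpair i k hi hk]
    have hL : {k | a k < 0}.Finite := Set.toFinite _
    have hP : {i | 0 < a i}.Finite := Set.toFinite _
    rcases {k | a k < 0}.eq_empty_or_nonempty with hemp | hne
    · obtain ⟨t, ht⟩ := (hP.image fun i => r i / a i).bddBelow
      refine ⟨t, fun k hk => ?_, fun i hi => ht ⟨i, hi, rfl⟩⟩
      exact absurd (show k ∈ {k | a k < 0} from hk) (by simp [hemp])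
    · obtain ⟨k₀, hk₀, hmax⟩ := hL.exists_maximalFor (fun k => r k / a k) _ hne
      refine ⟨r k₀ / a k₀, fun k hk => ?_, fun i hi => hle i k₀ hi hk₀⟩
      rcases le_total (r k / a k) (r k₀ / a k₀) with h | h
      · exact h
      · exact hmax hk h
  obtain ⟨t, hlow, hup⟩ := hbounds
  refine ⟨t, fun i => ?_⟩
  rcases lt_trichotomy (a i) 0 with hi | hi | hi
  · have := (div_le_iff_of_neg hi).1 (hlow i hi)
    linarith
  · simpa [hi] using hzero i hi
  · have := (le_div_iff₀ hi).1 (hup i hi)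
    linarith

/-- **Fourier–Motzkin elimination** of one variable with coefficient vector `a`: a nonnegative
matrix annihilating `a` whose rows witness solvability in that variable. -/
lemma exists_elimination_matrix.{u} {ι : Type u} [Fintype ι] (a : ι → ℝ) :
    ∃ (κ : Type u) (_ : Fintype κ) (M : Matrix κ ι ℝ), (∀ q i, 0 ≤ M q i) ∧ M *ᵥ a = 0 ∧
      ∀ r : ι → ℝ, 0 ≤ M *ᵥ r → ∃ t : ℝ, ∀ i, a i * t ≤ r i := by
  classical
  let pairRow : {p : ι × ι // 0 < a p.1 ∧ a p.2 < 0} → ι → ℝ :=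
    fun p => Pi.single p.1.1 (-a p.1.2) + Pi.single p.1.2 (a p.1.1)
  let zeroRow : {i : ι // a i = 0} → ι → ℝ := fun i => Pi.single i.1 1
  have hpair : ∀ i k (hi : 0 < a i) (hk : a k < 0) (r : ι → ℝ),
      pairRow ⟨(i, k), hi, hk⟩ ⬝ᵥ r = -a k * r i + a i * r k := fun i k hi hk r => by
    simp only [pairRow, add_dotProduct, single_dotProduct]
  refine ⟨_, inferInstance, Matrix.of (Sum.elim pairRow zeroRow), ?_, ?_, ?_⟩
  · rintro (⟨⟨i, k⟩, hi, hk⟩ | ⟨i, hi⟩)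
    · have h : 0 ≤ Pi.single i (-a k) + (Pi.single k (a i) : ι → ℝ) :=
        add_nonneg (Pi.single_nonneg.2 (neg_nonneg.2 hk.le)) (Pi.single_nonneg.2 hi.le)
      exact h
    · have h : 0 ≤ (Pi.single i 1 : ι → ℝ) := Pi.single_nonneg.2 zero_le_one
      exact h
  · ext q
    rcases q with ⟨⟨i, k⟩, hi, hk⟩ | ⟨i, hi⟩
    · change pairRow ⟨(i, k), hi, hk⟩ ⬝ᵥ a = 0
      rw [hpair i k hi hk]
      ring
    · simp [mulVec, zeroRow, hi]
  · intro r hr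
    refine exists_forall_mul_le_of_pairwise a r (fun i hi => ?_) fun i k hi hk => ?_
    · simpa [mulVec, zeroRow] using hr (Sum.inr ⟨i, hi⟩)
    · rw [← hpair i k hi hk]
      exact hr (Sum.inl ⟨(i, k), hi, hk⟩)

/-- **Farkas' lemma** for systems of linear inequalities. -/
theorem exists_mulVec_le_of_forall_vecMul_eq_zero {ι : Type*} [Fintype ι] {n : ℕ}
    (A : Matrix ι (Fin n) ℝ) (b : ι → ℝ)
    (h : ∀ y : ι → ℝ, 0 ≤ y → y ᵥ* A = 0 → 0 ≤ y ⬝ᵥ b) : ∃ x : Fin n → ℝ, A *ᵥ x ≤ b := by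
  classical
  induction n generalizing ι with
  | zero =>
    refine ⟨0, fun i => ?_⟩
    simpa using h (Pi.single i 1) (Pi.single_nonneg.2 zero_le_one) (Subsingleton.elim _ _)
  | succ n ih =>
    obtain ⟨κ, _, M, hM, hMa, helim⟩ := exists_elimination_matrix fun i => A i 0
    let A' : Matrix ι (Fin n) ℝ := A.submatrix id Fin.succ
    obtain ⟨x, hx⟩ := ih (M * A') (M *ᵥ b) fun y hy hyA => by
      rw [dotProduct_mulVec]
      refine h _ (fun i => Finset.sum_nonneg fun q _ => mul_nonneg (hy q) (hM q i)) ?_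
      ext j
      refine Fin.cases ?_ (fun j => ?_) j
      · change (y ᵥ* M) ⬝ᵥ (fun i => A i 0) = 0
        rw [← dotProduct_mulVec, hMa, dotProduct_zero]
      · rw [← vecMul_vecMul] at hyA
        exact congrFun hyA j
    obtain ⟨t, ht⟩ := helim (b - A' *ᵥ x) (by
      rw [mulVec_sub, mulVec_mulVec]
      exact sub_nonneg.2 hx)
    refine ⟨Fin.cons t x, fun i => ?_⟩
    have hi : A i 0 * t ≤ b i - ∑ j : Fin n, A i j.succ * x j := ht i
    simp only [mulVec, dotProduct, Fin.sum_univ_succ, Fin.cons_zero, Fin.cons_succ]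
    linarith

/-- With `A = [A₁; A₂]`, `A₂` invertible, `U = [[I, −A₁A₂⁻¹],[0,0]]`:
`P(A,b) ≠ ∅` iff for every `k` there exists `c ≤ b` with `kᵀ U c = 0`. -/
theorem stmt4 (p n : ℕ) (hp : 1 ≤ p) (hn : 1 ≤ n)
    (A₁ : Matrix (Fin p) (Fin n) ℝ) (A₂ : Matrix (Fin n) (Fin n) ℝ)
    (hA₂ : IsUnit A₂.det)
    (A : Matrix (Fin p ⊕ Fin n) (Fin n) ℝ)
    (hA : A = Matrix.fromRows A₁ A₂)
    (b : (Fin p ⊕ Fin n) → ℝ)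
    (U : Matrix (Fin p ⊕ Fin n) (Fin p ⊕ Fin n) ℝ)
    (hU : U = Matrix.fromBlocks 1 (-(A₁ * A₂⁻¹)) 0 0) :
    {x : Fin n → ℝ | A *ᵥ x ≤ b}.Nonempty ↔
      ∀ k : (Fin p ⊕ Fin n) → ℝ,
        ∃ c : (Fin p ⊕ Fin n) → ℝ, c ≤ b ∧ k ⬝ᵥ (U *ᵥ c) = 0 := by
  have hinv : A₂⁻¹ * A₂ = 1 := nonsing_inv_mul A₂ hA₂
  subst hA hU
  constructor
  · rintro ⟨x, hx⟩ k
    refine ⟨fromRows A₁ A₂ *ᵥ x, hx, ?_⟩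
    have hUA : fromBlocks 1 (-(A₁ * A₂⁻¹)) (0 : Matrix (Fin n) (Fin p) ℝ) 0 *
        fromRows A₁ A₂ = 0 := by
      rw [fromBlocks_mul_fromRows]
      simp [Matrix.mul_assoc, hinv]
    rw [mulVec_mulVec, hUA, zero_mulVec, dotProduct_zero]
  · intro h
    refine exists_mulVec_le_of_forall_vecMul_eq_zero _ b fun y hy hyA => ?_
    obtain ⟨c, hc, hkc⟩ := h (Sum.elim (y ∘ Sum.inl) 0)
    have hyU : Sum.elim (y ∘ Sum.inl) 0 ᵥ*
        fromBlocks 1 (-(A₁ * A₂⁻¹)) (0 : Matrix (Fin n) (Fin p) ℝ) 0 = y := by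
      rw [vecMul_fromRows] at hyA
      have hy₂ : -((y ∘ Sum.inl) ᵥ* (A₁ * A₂⁻¹)) = y ∘ Sum.inr := by
        rw [← vecMul_vecMul, eq_neg_of_add_eq_zero_left hyA, neg_vecMul, neg_neg, vecMul_vecMul,
          mul_nonsing_inv A₂ hA₂, vecMul_one]
      rw [vecMul_fromBlocks]
      simp [vecMul_neg, hy₂]
    rw [dotProduct_mulVec, hyU] at hkc
    rw [← hkc]
    exact dotProduct_le_dotProduct_of_nonneg_left hc hy
end
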